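/- arXiv:2205.08385 — 2 statements merged into one kernel-verified Lean document; each statement's English description precedes it below -/
import Mathlib

section
/- Let n ≥ p be positive integers, let ℒ : ℝ^{n×p} → ℝ be differentiable with Euclidean gradient ∇ℒ, let η, γ, k₁, k₂ > 0, and let W = {(θ,φ) ∈ ℝ^{n×p}×ℝ^{n×p} : ‖θᵀθ − I‖ < 1}. Define D(θ,φ) = −γφ − ∇ℒ(θ), the vector field X(θ,φ) = (X_θ, X_φ) with X_θ = φ − θ(θᵀθ)^{-1}Sym(θᵀφ) and X_φ = θ(θᵀθ)^{-1}((θᵀθ)^{-1}θᵀφ·Sym(θᵀφ) − φᵀφ) + (D − θ(θᵀθ)^{-1}Sym(θᵀD))/η, and ∇V(θ,φ) = (k₁θ(θᵀθ − I) + k₂φ·Sym(θᵀφ), k₂θ·Sym(θᵀφ)). Then ⟨∇V(θ,φ), X(θ,φ)⟩ = 0 for all (θ,φ) ∈ W, where ⟨(A₁,A₂),(B₁,B₂)⟩ = ⟨A₁,B₁⟩ + ⟨A₂,B₂⟩. -/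
open Matrix Set Filter

attribute [local instance] Matrix.normedAddCommGroup Matrix.normedSpace

noncomputable section

/-- `Sym(A) = (A + Aᵀ)/2`. -/
def symPart {p : ℕ} (A : Matrix (Fin p) (Fin p) ℝ) : Matrix (Fin p) (Fin p) ℝ :=
  (1 / 2 : ℝ) • (A + Aᵀ)

/-- Euclidean (Frobenius) inner product `⟨A, B⟩ = tr(AᵀB)`. -/
def mInner {m k : ℕ} (A B : Matrix (Fin m) (Fin k) ℝ) : ℝ := (Aᵀ * B).trace

/-- The norm induced from `mInner`. -/
def mNorm {m k : ℕ} (A : Matrix (Fin m) (Fin k) ℝ) : ℝ := Real.sqrt (mInner A A)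

/-- `∇V(θ,φ) = (k₁θ(θᵀθ - I) + k₂φ·Sym(θᵀφ), k₂θ·Sym(θᵀφ))`. -/
def gradV {n p : ℕ} (k₁ k₂ : ℝ)
    (q : Matrix (Fin n) (Fin p) ℝ × Matrix (Fin n) (Fin p) ℝ) :
    Matrix (Fin n) (Fin p) ℝ × Matrix (Fin n) (Fin p) ℝ :=
  (k₁ • (q.1 * (q.1ᵀ * q.1 - 1)) + k₂ • (q.2 * symPart (q.1ᵀ * q.2)),
    k₂ • (q.1 * symPart (q.1ᵀ * q.2)))

/-- The extended vector field `X = (X_θ, X_φ)` of system (7) on the ambient space. -/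
def extVF {n p : ℕ} (η γ : ℝ)
    (G : Matrix (Fin n) (Fin p) ℝ → Matrix (Fin n) (Fin p) ℝ)
    (q : Matrix (Fin n) (Fin p) ℝ × Matrix (Fin n) (Fin p) ℝ) :
    Matrix (Fin n) (Fin p) ℝ × Matrix (Fin n) (Fin p) ℝ :=
  (q.2 - q.1 * (q.1ᵀ * q.1)⁻¹ * symPart (q.1ᵀ * q.2),
    q.1 * (q.1ᵀ * q.1)⁻¹ *
        ((q.1ᵀ * q.1)⁻¹ * (q.1ᵀ * q.2) * symPart (q.1ᵀ * q.2) - q.2ᵀ * q.2) +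
      η⁻¹ • ((-(γ • q.2) - G q.1) -
        q.1 * (q.1ᵀ * q.1)⁻¹ * symPart (q.1ᵀ * (-(γ • q.2) - G q.1))))

theorem aux_isUnit {p : ℕ} (M : Matrix (Fin p) (Fin p) ℝ) (h : mNorm (M - 1) < 1) :
    IsUnit M.det := by
  rw [isUnit_iff_ne_zero]
  intro hdet
  obtain ⟨v, hv, hMv⟩ := Matrix.exists_mulVec_eq_zero_iff.mpr hdet
  have hE : (M - 1) *ᵥ v = -v := by
    rw [Matrix.sub_mulVec, hMv, Matrix.one_mulVec, zero_sub]
  generalize M - 1 = E at h hE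
  have h1 : mInner E E < 1 := by
    unfold mNorm at h
    rw [Real.sqrt_lt' one_pos] at h
    simpa using h
  have h2 : mInner E E = ∑ i, ∑ j, E i j ^ 2 := by
    unfold mInner
    simp only [Matrix.trace, Matrix.diag, Matrix.mul_apply, Matrix.transpose_apply]
    rw [Finset.sum_comm]
    simp only [pow_two]
  have hpos : 0 < ∑ j, v j ^ 2 := by
    obtain ⟨j, hj⟩ := Function.ne_iff.mp hv
    exact Finset.sum_pos' (fun _ _ => sq_nonneg _) ⟨j, Finset.mem_univ _, by
      have : v j ≠ 0 := hj
      positivity⟩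
  have h3 : ∑ i, v i ^ 2 ≤ (∑ i, ∑ j, E i j ^ 2) * ∑ j, v j ^ 2 := by
    rw [Finset.sum_mul]
    refine Finset.sum_le_sum fun i _ => ?_
    have h4 : ∑ j, E i j * v j = - v i := congrFun hE i
    have h5 := Finset.sum_mul_sq_le_sq_mul_sq Finset.univ (fun j => E i j) v
    rw [h4] at h5
    simpa using h5
  rw [← h2] at h3
  nlinarith

theorem symPart_transpose {p : ℕ} (A : Matrix (Fin p) (Fin p) ℝ) :
    (symPart A)ᵀ = symPart A := by
  simp [symPart, add_comm]

theorem trace_sym_mul {p : ℕ} (S A : Matrix (Fin p) (Fin p) ℝ) (hS : Sᵀ = S) :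
    (S * symPart A).trace = (S * A).trace := by
  have h : (S * Aᵀ).trace = (S * A).trace := by
    rw [← Matrix.trace_transpose, Matrix.transpose_mul, Matrix.transpose_transpose, hS,
      Matrix.trace_mul_comm]
  simp only [symPart, Matrix.mul_smul, Matrix.mul_add, Matrix.trace_smul, Matrix.trace_add, h,
    smul_eq_mul]
  ring

/-- Lemma 4: `⟨∇V(θ,φ), X(θ,φ)⟩ = 0` for all `(θ,φ) ∈ W`. -/
theorem stmt6 (n p : ℕ) (hp : 0 < p) (hpn : p ≤ n)
    (L : Matrix (Fin n) (Fin p) ℝ → ℝ)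
    (G : Matrix (Fin n) (Fin p) ℝ → Matrix (Fin n) (Fin p) ℝ)
    (L' : Matrix (Fin n) (Fin p) ℝ → (Matrix (Fin n) (Fin p) ℝ →L[ℝ] ℝ))
    (hLdiff : ∀ X, HasFDerivAt L (L' X) X)
    (hLgrad : ∀ X H, L' X H = mInner (G X) H)
    (η γ k₁ k₂ : ℝ) (hη : 0 < η) (hγ : 0 < γ) (hk₁ : 0 < k₁) (hk₂ : 0 < k₂)
    (θ φ : Matrix (Fin n) (Fin p) ℝ)
    (hW : mNorm (θᵀ * θ - 1) < 1) :
    mInner (gradV k₁ k₂ (θ, φ)).1 (extVF η γ G (θ, φ)).1 +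
      mInner (gradV k₁ k₂ (θ, φ)).2 (extVF η γ G (θ, φ)).2 = 0 := by
  have hu := aux_isUnit _ hW
  simp only [gradV, extVF, mInner]
  generalize -(γ • φ) - G θ = D
  have hS := symPart_transpose (θᵀ * φ)
  have hkS := trace_sym_mul (θᵀ * θ - 1) (θᵀ * φ) (by simp)
  have hDS := trace_sym_mul (symPart (θᵀ * φ)) (θᵀ * D) hS
  generalize symPart (θᵀ * φ) = S at *
  generalize symPart (θᵀ * D) = T at *
  have hMN : ∀ Z : Matrix (Fin p) (Fin p) ℝ, θᵀ * (θ * ((θᵀ * θ)⁻¹ * Z)) = Z := by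
    intro Z
    rw [← Matrix.mul_assoc, ← Matrix.mul_assoc, Matrix.mul_nonsing_inv _ hu, Matrix.one_mul]
  have hN : ((θᵀ * θ)⁻¹)ᵀ = (θᵀ * θ)⁻¹ := by
    rw [Matrix.transpose_nonsing_inv]; simp
  generalize (θᵀ * θ)⁻¹ = N at *
  have e1 : ((θ * (θᵀ * θ - 1))ᵀ * (φ - θ * N * S)).trace = 0 := by
    have : (θ * (θᵀ * θ - 1))ᵀ * (φ - θ * N * S)
        = (θᵀ * θ - 1) * (θᵀ * φ) - (θᵀ * θ - 1) * S := by
      rw [Matrix.transpose_mul, Matrix.mul_assoc, Matrix.mul_sub, Matrix.mul_assoc, hMN,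
        Matrix.mul_sub]
      simp
    rw [this, Matrix.trace_sub, hkS, sub_self]
  have e2 : ((θ * S)ᵀ * (D - θ * N * T)).trace = 0 := by
    have : (θ * S)ᵀ * (D - θ * N * T) = S * (θᵀ * D) - S * T := by
      rw [Matrix.transpose_mul, Matrix.mul_assoc, Matrix.mul_sub, Matrix.mul_assoc, hMN,
        Matrix.mul_sub, hS]
    rw [this, Matrix.trace_sub, hDS, sub_self]
  have e3 : ((φ * S)ᵀ * (φ - θ * N * S)).trace
      + ((θ * S)ᵀ * (θ * N * (N * (θᵀ * φ) * S - φᵀ * φ))).trace = 0 := by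
    have a1 : (φ * S)ᵀ * (φ - θ * N * S) = S * (φᵀ * φ) - S * (φᵀ * (θ * (N * S))) := by
      rw [Matrix.transpose_mul, Matrix.mul_assoc, Matrix.mul_sub, Matrix.mul_assoc,
        Matrix.mul_sub, hS]
    have a2 : (θ * S)ᵀ * (θ * N * (N * (θᵀ * φ) * S - φᵀ * φ))
        = S * (N * (θᵀ * φ) * S) - S * (φᵀ * φ) := by
      rw [Matrix.transpose_mul, Matrix.mul_assoc, Matrix.mul_assoc, hMN, Matrix.mul_sub, hS]
    have a3 : (S * (φᵀ * (θ * (N * S)))).trace = (S * (N * (θᵀ * φ) * S)).trace := by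
      rw [← Matrix.trace_transpose]
      simp only [Matrix.transpose_mul, Matrix.transpose_transpose, hS, hN, Matrix.mul_assoc]
    rw [a1, a2, Matrix.trace_sub, Matrix.trace_sub, a3]
    ring
  rw [Matrix.transpose_add, Matrix.add_mul, Matrix.mul_add, Matrix.trace_add, Matrix.trace_add]
  simp only [Matrix.transpose_smul, Matrix.smul_mul, Matrix.mul_smul, Matrix.trace_smul,
    smul_eq_mul, e1, e2]
  linear_combination k₂ * e3
end
end

section
/- Let n ≥ p be positive integers, k₁, k₂ > 0, and let W = {(θ,φ) ∈ ℝ^{n×p}×ℝ^{n×p} : ‖θᵀθ − I‖ < 1}. Define V(θ,φ) = (k₁/4)‖θᵀθ − I‖² + (k₂/2)‖Sym(θᵀφ)‖², ∇V(θ,φ) = (∇_θV, ∇_φV) = (k₁θ(θᵀθ − I) + k₂φ·Sym(θᵀφ), k₂θ·Sym(θᵀφ)), and the block operator L(θ,φ) with blocks A = (1/(4k₁))θ(θᵀθ)^{-2}θᵀ, L₁ = −(1/(4k₁))θ(θᵀθ)^{-2}θᵀφ(θᵀθ)^{-1}θᵀ, and L₂ = (1/(4k₁))θ(θᵀθ)^{-1}φᵀθ(θᵀθ)^{-2}θᵀφ(θᵀθ)^{-1}θᵀ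 + (1/(2k₂))θ(θᵀθ)^{-2}θᵀ, acting by L∇V = (A∇_θV + L₁∇_φV, L₁ᵀ∇_θV + L₂∇_φV). Then ⟨∇V(θ,φ), L(θ,φ)∇V(θ,φ)⟩ = V(θ,φ) for all (θ,φ) ∈ W, where ⟨(A₁,A₂),(B₁,B₂)⟩ = ⟨A₁,B₁⟩ + ⟨A₂,B₂⟩. -/
open Matrix Set Filter

attribute [local instance] Matrix.normedAddCommGroup Matrix.normedSpace

noncomputable section

/-- `V(θ,φ) = (k₁/4)‖θᵀθ - I‖² + (k₂/2)‖Sym(θᵀφ)‖²`. -/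
def Vfun {n p : ℕ} (k₁ k₂ : ℝ)
    (q : Matrix (Fin n) (Fin p) ℝ × Matrix (Fin n) (Fin p) ℝ) : ℝ :=
  k₁ / 4 * mNorm (q.1ᵀ * q.1 - 1) ^ 2 + k₂ / 2 * mNorm (symPart (q.1ᵀ * q.2)) ^ 2

/-- The block `A = (1/(4k₁))θ(θᵀθ)⁻²θᵀ` of the operator `L(θ,φ)`. -/
def Lblk {n p : ℕ} (k₁ : ℝ) (θ : Matrix (Fin n) (Fin p) ℝ) :
    Matrix (Fin n) (Fin n) ℝ :=
  (1 / (4 * k₁)) • (θ * ((θᵀ * θ)⁻¹ * (θᵀ * θ)⁻¹) * θᵀ)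

/-- The block `L₁ = -(1/(4k₁))θ(θᵀθ)⁻²θᵀφ(θᵀθ)⁻¹θᵀ` of the operator `L(θ,φ)`. -/
def L1blk {n p : ℕ} (k₁ : ℝ) (θ φ : Matrix (Fin n) (Fin p) ℝ) :
    Matrix (Fin n) (Fin n) ℝ :=
  -((1 / (4 * k₁)) • (θ * ((θᵀ * θ)⁻¹ * (θᵀ * θ)⁻¹) * θᵀ * φ * (θᵀ * θ)⁻¹ * θᵀ))

/-- The block `L₂ = (1/(4k₁))θ(θᵀθ)⁻¹φᵀθ(θᵀθ)⁻²θᵀφ(θᵀθ)⁻¹θᵀ + (1/(2k₂))θ(θᵀθ)⁻²θᵀ`. -/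
def L2blk {n p : ℕ} (k₁ k₂ : ℝ) (θ φ : Matrix (Fin n) (Fin p) ℝ) :
    Matrix (Fin n) (Fin n) ℝ :=
  (1 / (4 * k₁)) • (θ * (θᵀ * θ)⁻¹ * φᵀ * θ * ((θᵀ * θ)⁻¹ * (θᵀ * θ)⁻¹) * θᵀ * φ *
      (θᵀ * θ)⁻¹ * θᵀ) +
    (1 / (2 * k₂)) • (θ * ((θᵀ * θ)⁻¹ * (θᵀ * θ)⁻¹) * θᵀ)

lemma mInner_self_eq {m k : ℕ} (A : Matrix (Fin m) (Fin k) ℝ) :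
    mInner A A = ∑ i, ∑ j, A i j ^ 2 := by
  unfold mInner
  rw [Finset.sum_comm]
  simp [Matrix.trace, Matrix.mul_apply, sq]

lemma mInner_self_nonneg {m k : ℕ} (A : Matrix (Fin m) (Fin k) ℝ) : 0 ≤ mInner A A := by
  rw [mInner_self_eq]; positivity

lemma mNorm_sq {m k : ℕ} (A : Matrix (Fin m) (Fin k) ℝ) : mNorm A ^ 2 = mInner A A :=
  Real.sq_sqrt (mInner_self_nonneg A)

lemma det_ne_zero_of_mNorm {p : ℕ} (G : Matrix (Fin p) (Fin p) ℝ) (h : mNorm (G - 1) < 1) :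
    G.det ≠ 0 := by
  intro hd
  obtain ⟨v, hv, hGv⟩ := Matrix.exists_mulVec_eq_zero_iff.mpr hd
  have hE : (G - 1) *ᵥ v = -v := by
    rw [Matrix.sub_mulVec, hGv, Matrix.one_mulVec, zero_sub]
  have hlt : mInner (G - 1) (G - 1) < 1 := by
    rw [← mNorm_sq]
    have h0 : 0 ≤ mNorm (G - 1) := Real.sqrt_nonneg _
    nlinarith
  have hpos : 0 < ∑ j, v j ^ 2 := by
    obtain ⟨i, hi⟩ := Function.ne_iff.mp hv
    exact Finset.sum_pos' (fun j _ => sq_nonneg _) ⟨i, Finset.mem_univ i, by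
      have : v i ≠ 0 := hi
      positivity⟩
  have hle : ∑ i, v i ^ 2 ≤ (∑ i, ∑ j, (G - 1) i j ^ 2) * ∑ j, v j ^ 2 := by
    rw [Finset.sum_mul]
    refine Finset.sum_le_sum fun i _ => ?_
    have h1 : (∑ j, (G - 1) i j * v j) = - v i := congrFun hE i
    have h2 := Finset.sum_mul_sq_le_sq_mul_sq Finset.univ (fun j => (G - 1) i j) v
    rw [h1, neg_sq] at h2
    exact h2
  rw [← mInner_self_eq] at hle
  nlinarith

lemma mInner_factor {n p : ℕ} (c d : ℝ) (X Y : Matrix (Fin n) (Fin p) ℝ)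
    (U W : Matrix (Fin n) (Fin p) ℝ) :
    mInner X ((c • (U * Uᵀ)) * X + (-(c • (U * Wᵀ))) * Y) +
      mInner Y ((-(c • (U * Wᵀ)))ᵀ * X + (c • (W * Wᵀ) + d • (U * Uᵀ)) * Y) =
    c * mInner (Uᵀ * X - Wᵀ * Y) (Uᵀ * X - Wᵀ * Y) + d * mInner (Uᵀ * Y) (Uᵀ * Y) := by
  unfold mInner
  simp only [Matrix.transpose_sub, Matrix.transpose_mul, Matrix.transpose_neg,
    Matrix.transpose_smul, Matrix.transpose_transpose, Matrix.mul_add, Matrix.add_mul,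
    Matrix.sub_mul, Matrix.mul_sub, Matrix.neg_mul, Matrix.mul_neg, Matrix.smul_mul,
    Matrix.mul_smul, Matrix.trace_add, Matrix.trace_sub, Matrix.trace_neg, Matrix.trace_smul,
    smul_eq_mul, Matrix.mul_assoc]
  ring

/-- Lemma 5: `⟨∇V(θ,φ), L(θ,φ)∇V(θ,φ)⟩ = V(θ,φ)` on `W`. -/
theorem stmt7 (n p : ℕ) (hp : 0 < p) (hpn : p ≤ n)
    (k₁ k₂ : ℝ) (hk₁ : 0 < k₁) (hk₂ : 0 < k₂)
    (θ φ : Matrix (Fin n) (Fin p) ℝ)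
    (hW : mNorm (θᵀ * θ - 1) < 1) :
    mInner (gradV k₁ k₂ (θ, φ)).1
        (Lblk k₁ θ * (gradV k₁ k₂ (θ, φ)).1 + L1blk k₁ θ φ * (gradV k₁ k₂ (θ, φ)).2) +
      mInner (gradV k₁ k₂ (θ, φ)).2
        ((L1blk k₁ θ φ)ᵀ * (gradV k₁ k₂ (θ, φ)).1 +
          L2blk k₁ k₂ θ φ * (gradV k₁ k₂ (θ, φ)).2) =
      Vfun k₁ k₂ (θ, φ) := by
  have hdet := det_ne_zero_of_mNorm _ hW
  have hu : IsUnit (θᵀ * θ).det := isUnit_iff_ne_zero.mpr hdet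
  have hHG : (θᵀ * θ)⁻¹ * (θᵀ * θ) = 1 := Matrix.nonsing_inv_mul _ hu
  have hHt : ((θᵀ * θ)⁻¹)ᵀ = (θᵀ * θ)⁻¹ := by
    rw [Matrix.transpose_nonsing_inv, Matrix.transpose_mul, Matrix.transpose_transpose]
  unfold Vfun
  rw [mNorm_sq, mNorm_sq]
  simp only [gradV]
  generalize symPart (θᵀ * φ) = S
  generalize hE : θᵀ * θ - 1 = E
  unfold Lblk L1blk L2blk
  generalize (θᵀ * θ)⁻¹ = H at *
  have hA : θ * (H * H) * θᵀ = (θ * H) * (θ * H)ᵀ := by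
    simp only [Matrix.transpose_mul, hHt, Matrix.mul_assoc]
  have hB : θ * (H * H) * θᵀ * φ * H * θᵀ = (θ * H) * (θ * H * φᵀ * θ * H)ᵀ := by
    simp only [Matrix.transpose_mul, Matrix.transpose_transpose, hHt, Matrix.mul_assoc]
  have hC : θ * H * φᵀ * θ * (H * H) * θᵀ * φ * H * θᵀ =
      (θ * H * φᵀ * θ * H) * (θ * H * φᵀ * θ * H)ᵀ := by
    simp only [Matrix.transpose_mul, Matrix.transpose_transpose, hHt, Matrix.mul_assoc]
  rw [hB, hC, hA, mInner_factor]
  have key : ∀ Z : Matrix (Fin p) (Fin p) ℝ, H * (θᵀ * (θ * Z)) = Z := fun Z => by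
    rw [← Matrix.mul_assoc θᵀ, ← Matrix.mul_assoc, hHG, Matrix.one_mul]
  have h1 : (θ * H)ᵀ * (k₂ • (θ * S)) = k₂ • S := by
    simp only [Matrix.transpose_mul, hHt, Matrix.mul_assoc, Matrix.mul_smul, key]
  have h2 : (θ * H)ᵀ * (k₁ • (θ * E) + k₂ • (φ * S)) -
      (θ * H * φᵀ * θ * H)ᵀ * (k₂ • (θ * S)) = k₁ • E := by
    simp only [Matrix.transpose_mul, Matrix.transpose_transpose, hHt, Matrix.mul_assoc,
      Matrix.mul_smul, Matrix.mul_add, key, add_sub_cancel_right]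
  rw [h1, h2]
  unfold mInner
  simp only [Matrix.transpose_smul, Matrix.smul_mul, Matrix.mul_smul, Matrix.trace_smul,
    smul_eq_mul]
  field_simp
end
end
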